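/- If a polytope P has d+2 or fewer facets where d = dim P, and P is not a pyramid, then d ≤ α + 1, where d + 1 + α is the number of vertices of P. Equivalently: a d-polytope with at most d+2 facets that is not a pyramid has at least 2d vertices. -/

import Mathlib

open Set

section Prelim

variable {E : Type*} [AddCommGroup E] [Module ℝ E] {F : Type*} [AddCommGroup F] [Module ℝ F]

/-- A polytope is the convex hull of a nonempty finite set of points. -/
def IsPolytope (P : Set E) : Prop :=
  ∃ S : Finset E, S.Nonempty ∧ P = convexHull ℝ (S : Set E)

/-- The dimension of a set: the dimension of its affine hull. -/
noncomputable def pdim (P : Set E) : ℕ :=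
  Module.finrank ℝ (affineSpan ℝ P).direction

/-- The number of vertices (extreme points). -/
noncomputable def numVertices (P : Set E) : ℕ :=
  (P.extremePoints ℝ).ncard

/-- A face of a polytope: a convex extreme subset. -/
def IsFace (P A : Set E) : Prop :=
  IsExtreme ℝ P A ∧ Convex ℝ A

/-- A facet: a face of dimension one less than the polytope. -/
def IsFacet (P A : Set E) : Prop :=
  A.Nonempty ∧ IsFace P A ∧ pdim A + 1 = pdim P

/-- The number of facets. -/
noncomputable def numFacets (P : Set E) : ℕ :=
  {A : Set E | IsFacet P A}.ncard

/-- A `k`-dimensional simplex: convex hull of `k+1` affinely independent points. -/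
def IsSimplex (k : ℕ) (P : Set E) : Prop :=
  ∃ S : Finset E, S.card = k + 1 ∧
    AffineIndependent ℝ (fun x : (S : Set E) => (x : E)) ∧
    P = convexHull ℝ (S : Set E)

/-- A pyramid: convex hull of a polytope together with a point outside its affine hull. -/
def IsPyramid (P : Set E) : Prop :=
  ∃ (Q : Set E) (v : E), IsPolytope Q ∧ v ∉ affineSpan ℝ Q ∧
    P = convexHull ℝ (Q ∪ {v})

/-- The join of two polytopes, realized in skew affine subspaces of `E × F × ℝ`. -/
def polyJoin (P : Set E) (Q : Set F) : Set (E × F × ℝ) :=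
  convexHull ℝ ((fun p => (p, (0 : F), (0 : ℝ))) '' P ∪ (fun q => ((0 : E), q, (1 : ℝ))) '' Q)

/-- Combinatorial equivalence: an inclusion-preserving bijection between the face posets. -/
def CombEquiv (P : Set E) (Q : Set F) : Prop :=
  Nonempty ({A : Set E // IsFace P A} ≃o {B : Set F // IsFace Q B})

end Prelim


section Core

variable {U : Type*} [AddCommGroup U] [Module ℝ U]

/-- Algebraic Farkas lemma (Bartl's proof). -/
lemma farkas_aux {ι : Type*} [DecidableEq ι] (s : Finset ι) :
    ∀ (v : ι → U) (x : U),
    (∀ l : U →ₗ[ℝ] ℝ, (∀ i ∈ s, 0 ≤ l (v i)) → 0 ≤ l x) →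
    ∃ c : ι → ℝ, (∀ i, 0 ≤ c i) ∧ x = ∑ i ∈ s, c i • v i := by
  induction s using Finset.induction_on with
  | empty =>
    intro v x h
    refine ⟨fun _ => 0, fun _ => le_rfl, ?_⟩
    have : ∀ l : Module.Dual ℝ U, l x = 0 := by
      intro l
      have h1 := h l (by simp)
      have h2 := h (-l) (by simp)
      simp at h2
      linarith
    simpa using (Module.forall_dual_apply_eq_zero_iff ℝ x).1 this
  | insert n s hn ih =>
    intro v x h
    by_cases hs : ∀ l : U →ₗ[ℝ] ℝ, (∀ i ∈ s, 0 ≤ l (v i)) → 0 ≤ l x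
    · obtain ⟨c, hc, hx⟩ := ih v x hs
      refine ⟨fun i => if i = n then 0 else c i, fun i => by dsimp; split_ifs <;> simp [hc], ?_⟩
      rw [Finset.sum_insert hn, hx]
      simp only [if_true, zero_smul, zero_add]
      refine Finset.sum_congr rfl fun i hi => ?_
      rw [if_neg (by rintro rfl; exact hn hi)]
    · push Not at hs
      obtain ⟨b, hb, hbx⟩ := hs
      have hbn : b (v n) < 0 := by
        by_contra hcon
        push Not at hcon
        have := h b (by
          intro i hi
          rcases Finset.mem_insert.1 hi with rfl | hi
          · exact hcon
          · exact hb i hi)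
        linarith
      obtain ⟨c, hc, hx⟩ := ih (fun i => v i - (b (v i) / b (v n)) • v n)
        (x - (b x / b (v n)) • v n) (by
          intro l hl
          have := h (l - (l (v n) / b (v n)) • b) (by
            intro i hi
            rcases Finset.mem_insert.1 hi with rfl | hi
            · simp [hbn.ne]
            · have := hl i hi
              simp at this ⊢
              have e : l (v n) / b (v n) * b (v i) = b (v i) / b (v n) * l (v n) := by ring
              linarith)
          simp at this ⊢
          have e : l (v n) / b (v n) * b x = b x / b (v n) * l (v n) := by ring
          linarith)
      set r : ℝ := b x / b (v n) - ∑ i ∈ s, c i * (b (v i) / b (v n)) with hr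
      have hr0 : 0 ≤ r := by
        have h1 : 0 ≤ b x / b (v n) := div_nonneg_of_nonpos hbx.le hbn.le
        have h2 : ∑ i ∈ s, c i * (b (v i) / b (v n)) ≤ 0 :=
          Finset.sum_nonpos fun i hi => mul_nonpos_of_nonneg_of_nonpos (hc i)
            (div_nonpos_of_nonneg_of_nonpos (hb i hi) hbn.le)
        linarith
      refine ⟨fun i => if i = n then r else c i, fun i => by dsimp; split_ifs <;> simp [hc, hr0], ?_⟩
      rw [Finset.sum_insert hn]
      simp only [if_true]
      have e : ∑ i ∈ s, (if i = n then r else c i) • v i = ∑ i ∈ s, c i • v i :=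
        Finset.sum_congr rfl fun i hi => by rw [if_neg (by rintro rfl; exact hn hi)]
      rw [e]
      have hx' : x = (b x / b (v n)) • v n + ∑ i ∈ s, c i • (v i - (b (v i) / b (v n)) • v n) := by
        rw [← hx]; abel
      simp only [smul_sub, Finset.sum_sub_distrib, smul_smul, ← Finset.sum_smul] at hx'
      rw [hr, sub_smul]
      conv_lhs => rw [hx']
      abel

/-- Facet functional. -/
def Facetlike {ι : Type*} (v : ι → U) (l : U →ₗ[ℝ] ℝ) : Prop :=
  (∀ i, 0 ≤ l (v i)) ∧ l ≠ 0 ∧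
    ∀ g : U →ₗ[ℝ] ℝ, (∀ i, l (v i) = 0 → g (v i) = 0) → ∃ c : ℝ, g = c • l

lemma sep_facet {ι : Type*} [Fintype ι] (v : ι → U) (hv : Submodule.span ℝ (range v) = ⊤)
    (x : U) (n : ℕ) : ∀ (l : U →ₗ[ℝ] ℝ), {i | l (v i) ≠ 0}.ncard ≤ n → (∀ i, 0 ≤ l (v i)) → l x < 0 →
    ∃ l', Facetlike v l' ∧ l' x < 0 := by
  classical
  have hext : ∀ g : U →ₗ[ℝ] ℝ, (∀ i, g (v i) = 0) → g = 0 := by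
    intro g hg
    apply LinearMap.ext_on_range hv
    simpa using hg
  induction n with
  | zero =>
    intro l hn hl hx
    exfalso
    have h0 : {i | l (v i) ≠ 0} = ∅ := (Set.ncard_eq_zero (toFinite _)).1 (by omega)
    have : l = 0 := hext l fun i => by
      by_contra h
      have : i ∈ {i | l (v i) ≠ 0} := h
      rw [h0] at this; exact this
    simp [this] at hx
  | succ n ih =>
    intro l hn hl hx
    by_cases hF : Facetlike v l
    · exact ⟨l, hF, hx⟩
    have hl0 : l ≠ 0 := by rintro rfl; simp at hx
    have hF' : ∃ g : U →ₗ[ℝ] ℝ, (∀ i, l (v i) = 0 → g (v i) = 0) ∧ ∀ c : ℝ, g ≠ c • l := by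
      by_contra hcon
      push Not at hcon
      exact hF ⟨hl, hl0, hcon⟩
    obtain ⟨g, hg, hgl⟩ := hF'
    have key : ∃ g' : U →ₗ[ℝ] ℝ, (∀ i, l (v i) = 0 → g' (v i) = 0) ∧ g' x = 0 ∧
        ∃ i, g' (v i) < 0 := by
      let g' := g - (g x / l x) • l
      have h1 : ∀ i, l (v i) = 0 → g' (v i) = 0 := by
        intro i hi; simp [g', hi, hg i hi]
      have h2 : g' x = 0 := by simp [g', hx.ne]
      have h3 : ∃ i, g' (v i) ≠ 0 := by
        by_contra hcon
        push Not at hcon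
        exact hgl _ (sub_eq_zero.1 (hext g' hcon))
      obtain ⟨i, hi⟩ := h3
      rcases lt_or_gt_of_ne hi with hi | hi
      · exact ⟨g', h1, h2, i, hi⟩
      · exact ⟨-g', fun i hi => by simp [h1 i hi], by simp [h2], i, by simpa using hi⟩
    obtain ⟨g', h1, h2, i1, hi1⟩ := key
    obtain ⟨i0, hi0, hmin⟩ := Finset.exists_min_image
      (Finset.univ.filter fun i => g' (v i) < 0) (fun i => l (v i) / (-g' (v i))) ⟨i1, by simp [hi1]⟩
    simp only [Finset.mem_filter, Finset.mem_univ, true_and] at hi0 hmin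
    set t := l (v i0) / (-g' (v i0)) with ht
    have ht0 : 0 ≤ t := div_nonneg (hl i0) (by linarith)
    refine ih (l + t • g') ?_ ?_ (by simp [h2, hx])
    · have hss : {i | (l + t • g') (v i) ≠ 0} ⊂ {i | l (v i) ≠ 0} := by
        refine (Set.ssubset_iff_of_subset ?_).2 ⟨i0, ?_, ?_⟩
        · intro i hi hli
          apply hi
          simp [hli, h1 i hli]
        · intro hli
          have := h1 i0 hli
          linarith
        · simp only [mem_ofPred_eq, not_not, LinearMap.add_apply, LinearMap.smul_apply, smul_eq_mul, ht]
          have : g' (v i0) ≠ 0 := hi0.ne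
          field_simp
          ring
      have := Set.ncard_lt_ncard hss (toFinite _)
      omega
    · intro i
      simp only [LinearMap.add_apply, LinearMap.smul_apply, smul_eq_mul]
      by_cases hi : g' (v i) < 0
      · have := hmin i hi
        rw [le_div_iff₀ (by linarith)] at this
        linarith
      · push Not at hi
        have := mul_nonneg ht0 hi
        linarith [hl i]

lemma zero_of_sum {ι : Type*} [Fintype ι] (v : ι → U) (l : U →ₗ[ℝ] ℝ) (hl : ∀ i, 0 ≤ l (v i))
    (c : ι → ℝ) (hc : ∀ i, 0 ≤ c i) (h : l (∑ i, c i • v i) = 0) (i : ι) (hi : c i ≠ 0) :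
    l (v i) = 0 := by
  simp only [map_sum, map_smul, smul_eq_mul] at h
  have := (Finset.sum_eq_zero_iff_of_nonneg (fun i _ => mul_nonneg (hc i) (hl i))).1 h i
    (Finset.mem_univ _)
  exact (mul_eq_zero.1 this).resolve_left hi

lemma core [FiniteDimensional ℝ U] {ι κ : Type*} [Fintype ι] [Fintype κ] (v : ι → U)
    (h : U →ₗ[ℝ] ℝ) (hh : ∀ i, h (v i) = 1) (l : κ → U →ₗ[ℝ] ℝ)
    (hl : ∀ k i, 0 ≤ l k (v i)) (hz : ∀ k, ∃ i, l k (v i) = 0)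
    (hcone : ∀ x, (∀ k, 0 ≤ l k x) → ∃ c : ι → ℝ, (∀ i, 0 ≤ c i) ∧ x = ∑ i, c i • v i)
    (hι : Nonempty ι)
    (hcard : Fintype.card κ ≤ Module.finrank ℝ U + 1) :
    2 * (Module.finrank ℝ U - 1) ≤ Fintype.card ι ∨
    ∃ k i0, l k (v i0) ≠ 0 ∧ ∀ w, ∃ c : ι → ℝ, (∀ i, 0 ≤ c i) ∧ v w = ∑ i, c i • v i ∧
      ∀ i, c i ≠ 0 → i = i0 ∨ l k (v i) = 0 := by
  classical
  have hv0 : ∀ i, v i ≠ 0 := fun i hi => by have := hh i; simp [hi] at this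
  have hker : ∀ x, (∀ k, l k x = 0) → x = 0 := by
    intro x hx
    obtain ⟨c, hc, hxc⟩ := hcone x (fun k => (hx k).ge)
    obtain ⟨c', hc', hxc'⟩ := hcone (-x) (fun k => by simp [hx k])
    have e1 : h x = ∑ i, c i := by rw [hxc]; simp [hh]
    have e2 : h (-x) = ∑ i, c' i := by rw [hxc']; simp [hh]
    have p1 : 0 ≤ ∑ i, c i := Finset.sum_nonneg fun i _ => hc i
    have p2 : 0 ≤ ∑ i, c' i := Finset.sum_nonneg fun i _ => hc' i
    rw [map_neg] at e2
    have p3 : ∑ i, c i = 0 := by linarith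
    have p4 := (Finset.sum_eq_zero_iff_of_nonneg (fun i _ => hc i)).1 p3
    rw [hxc]
    exact Finset.sum_eq_zero fun i hi => by rw [p4 i hi, zero_smul]
  let Φ : U →ₗ[ℝ] (κ → ℝ) := LinearMap.pi l
  have hΦ : ∀ x k, Φ x k = l k x := fun x k => rfl
  have hinj : Function.Injective Φ := by
    rw [injective_iff_map_eq_zero]
    intro x hx
    exact hker x fun k => by rw [← hΦ, hx]; rfl
  -- supports
  have hsupp : ∀ u, u ≠ 0 → (∀ k, 0 ≤ l k u) → ∃ i, ∀ k, l k u = 0 → l k (v i) = 0 := by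
    intro u hu hpos
    obtain ⟨c, hc, hxc⟩ := hcone u hpos
    have : ∃ i, c i ≠ 0 := by
      by_contra hcon
      push Not at hcon
      apply hu
      rw [hxc]
      simp [hcon]
    obtain ⟨i, hi⟩ := this
    refine ⟨i, fun k hk => zero_of_sum v (l k) (hl k) c hc (by rw [← hxc, hk]) i hi⟩
  by_cases hA : ∃ k, Pi.single k (1:ℝ) ∈ LinearMap.range Φ
  · right
    obtain ⟨k, u, hu⟩ := hA
    have hu' : ∀ j, l j u = Pi.single (M := fun _ => ℝ) k 1 j := fun j => by rw [← hΦ, hu]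
    have hu0 : u ≠ 0 := by
      rintro rfl
      have := hu' k
      simp at this
    obtain ⟨i0, hi0⟩ := hsupp u hu0 (fun j => by
      rw [hu' j]; by_cases hj : j = k
      · subst hj; simp
      · simp [hj])
    have hj0 : ∀ j, j ≠ k → l j (v i0) = 0 := fun j hj => hi0 j (by rw [hu' j]; simp [hj])
    have hk0 : l k (v i0) ≠ 0 := by
      intro h0
      apply hv0 i0
      apply hker
      intro j
      by_cases hj : j = k
      · subst hj; exact h0
      · exact hj0 j hj
    refine ⟨k, i0, hk0, fun w => ?_⟩
    obtain ⟨c, hc, hxc⟩ := hcone (v w - (l k (v w) / l k (v i0)) • v i0) (fun j => by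
      by_cases hj : j = k
      · subst hj; simp [hk0]
      · simp [hj0 j hj, hl j w])
    have hr : 0 ≤ l k (v w) / l k (v i0) := div_nonneg (hl _ _) (hl _ _)
    refine ⟨fun i => c i + if i = i0 then l k (v w) / l k (v i0) else 0, fun i => ?_, ?_, ?_⟩
    · have := hc i
      dsimp
      split_ifs <;> linarith
    · simp only [add_smul, Finset.sum_add_distrib, ← hxc, ite_smul, zero_smul, Finset.sum_ite_eq',
        Finset.mem_univ, if_true, sub_add_cancel]
    · intro i hi
      by_cases hii : i = i0
      · exact Or.inl hii
      · right
        simp only [hii, if_false, add_zero] at hi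
        exact zero_of_sum v (l k) (hl k) c hc (by rw [← hxc]; simp [hk0]) i hi
  · left
    push Not at hA
    by_cases hκ : Nonempty κ
    swap
    · exfalso
      obtain ⟨i⟩ := hι
      exact hv0 i (hker _ fun k => (hκ ⟨k⟩).elim)
    obtain ⟨k0⟩ := hκ
    obtain ⟨f, hf0, hf⟩ := Submodule.exists_le_ker_of_notMem (hA k0)
    have hfne : f ≠ 0 := by rintro rfl; simp at hf0
    have hfr : Module.finrank ℝ (LinearMap.range Φ) = Module.finrank ℝ U :=
      LinearMap.finrank_range_of_inj hinj
    have hfk : Module.finrank ℝ (LinearMap.ker f) + 1 = Fintype.card κ := by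
      have := Module.Dual.finrank_ker_add_one_of_ne_zero (K := ℝ) (f := f) hfne
      rw [this]; simp
    have hle : Module.finrank ℝ (LinearMap.range Φ) ≤ Module.finrank ℝ (LinearMap.ker f) :=
      Submodule.finrank_mono hf
    have heq : LinearMap.range Φ = LinearMap.ker f :=
      Submodule.eq_of_le_of_finrank_le hf (by omega)
    have hcard' : Fintype.card κ = Module.finrank ℝ U + 1 := by
      rw [heq] at hfr; omega
    set lam : κ → ℝ := fun k => f (Pi.single k 1) with hlam
    have hlam0 : ∀ k, lam k ≠ 0 := by
      intro k hk
      apply hA k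
      rw [heq]
      exact hk
    have hfsum : ∀ z : κ → ℝ, f z = ∑ k, z k * lam k := by
      intro z
      conv_lhs => rw [pi_eq_sum_univ' z]
      simp [hlam]
    have hrel : ∀ x, ∑ k, l k x * lam k = 0 := by
      intro x
      have : Φ x ∈ LinearMap.ker f := heq ▸ LinearMap.mem_range_self Φ x
      rw [LinearMap.mem_ker, hfsum] at this
      exact this
    let Pp := Finset.univ.filter fun k => 0 < lam k
    let Mm := Finset.univ.filter fun k => lam k < 0
    have hPM : Pp.card + Mm.card = Fintype.card κ := by
      have e : Mm = Finset.univ.filter fun k => ¬ 0 < lam k := by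
        ext k; simp [Mm, le_iff_lt_or_eq, hlam0 k]
      rw [e]
      exact Finset.card_filter_add_card_filter_not _
    -- neither sign class has at most one element
    have hone : ∀ s : ℝ, s ≠ 0 → 2 ≤ (Finset.univ.filter fun k => 0 < s * lam k).card := by
      intro s hs
      by_contra hcon
      have hle1 : (Finset.univ.filter fun k => 0 < s * lam k).card ≤ 1 := by omega
      rw [Finset.card_le_one] at hle1
      -- find vertex on which all positive l vanish
      have hex : ∃ i, ∀ k, 0 < s * lam k → l k (v i) = 0 := by
        by_cases hne : ∃ k, 0 < s * lam k
        · obtain ⟨k, hk⟩ := hne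
          obtain ⟨i, hi⟩ := hz k
          refine ⟨i, fun j hj => ?_⟩
          have : j = k := hle1 j (by simp [hj]) k (by simp [hk])
          rw [this, hi]
        · push Not at hne
          obtain ⟨i⟩ := hι
          exact ⟨i, fun k hk => absurd hk (not_lt.2 (hne k))⟩
      obtain ⟨i, hi⟩ := hex
      apply hv0 i
      apply hker
      have h1 : ∑ k, l k (v i) * (-(s * lam k)) = 0 := by
        have := hrel (v i)
        calc _ = -s * ∑ k, l k (v i) * lam k := by
              rw [Finset.mul_sum]; exact Finset.sum_congr rfl fun k _ => by ring
          _ = 0 := by rw [this, mul_zero]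
      have h2 : ∀ k ∈ Finset.univ, 0 ≤ l k (v i) * (-(s * lam k)) := by
        intro k _
        by_cases hk : 0 < s * lam k
        · simp [hi k hk]
        · exact mul_nonneg (hl _ _) (by linarith)
      intro k
      have h3 := (Finset.sum_eq_zero_iff_of_nonneg h2).1 h1 k (Finset.mem_univ _)
      refine (mul_eq_zero.1 h3).resolve_right ?_
      simp [hs, hlam0 k]
    have hP2 : 2 ≤ Pp.card := by simpa [Pp] using hone 1 one_ne_zero
    have hM2 : 2 ≤ Mm.card := by simpa [Mm] using hone (-1) (by norm_num)
    have hvert : ∀ p : κ × κ, p ∈ Pp ×ˢ Mm → ∃ i, ∀ k, l k (v i) ≠ 0 ↔ (k = p.1 ∨ k = p.2) := by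
      rintro ⟨a, b⟩ hab
      simp only [Finset.mem_product, Pp, Mm, Finset.mem_filter, Finset.mem_univ, true_and] at hab
      obtain ⟨ha, hb⟩ := hab
      have hne : a ≠ b := by rintro rfl; linarith
      let z : κ → ℝ := Pi.single a (-lam b) + Pi.single b (lam a)
      have hz : z ∈ LinearMap.range Φ := by
        rw [heq, LinearMap.mem_ker, hfsum]
        simp only [z, Pi.add_apply, add_mul, Finset.sum_add_distrib, Pi.single_apply, ite_mul,
          zero_mul, Finset.sum_ite_eq', Finset.mem_univ, if_true]
        ring
      obtain ⟨u, hu⟩ := hz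
      have hu' : ∀ k, l k u = z k := fun k => by rw [← hΦ, hu]
      have hzk : ∀ k, k ≠ a → k ≠ b → z k = 0 := fun k h1 h2 => by simp [z, h1, h2]
      have hza : z a = -lam b := by simp [z, hne]
      have hzb : z b = lam a := by simp [z, hne.symm]
      obtain ⟨i, hi⟩ := hsupp u (by
        rintro rfl
        have := hu' b
        rw [hzb] at this
        simp at this
        linarith) (fun k => by
          rw [hu' k]
          by_cases h1 : k = a
          · subst h1; rw [hza]; linarith
          · by_cases h2 : k = b
            · subst h2; rw [hzb]; linarith
            · rw [hzk k h1 h2])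
      have hi' : ∀ k, k ≠ a → k ≠ b → l k (v i) = 0 := fun k h1 h2 =>
        hi k (by rw [hu' k, hzk k h1 h2])
      have hs : l a (v i) * lam a + l b (v i) * lam b = 0 := by
        rw [← hrel (v i)]
        symm
        rw [← Finset.sum_subset (Finset.subset_univ {a, b})]
        · rw [Finset.sum_pair hne]
        · intro k _ hk
          simp at hk
          rw [hi' k hk.1 hk.2, zero_mul]
      have hab0 : l a (v i) = 0 ↔ l b (v i) = 0 := by
        constructor
        · intro h0
          rw [h0, zero_mul, zero_add] at hs
          exact (mul_eq_zero.1 hs).resolve_right hb.ne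
        · intro h0
          rw [h0, zero_mul, add_zero] at hs
          exact (mul_eq_zero.1 hs).resolve_right ha.ne'
      have hane : l a (v i) ≠ 0 := by
        intro h0
        apply hv0 i
        apply hker
        intro k
        by_cases h1 : k = a
        · subst h1; exact h0
        · by_cases h2 : k = b
          · subst h2; exact hab0.1 h0
          · exact hi' k h1 h2
      refine ⟨i, fun k => ⟨fun hk => ?_, ?_⟩⟩
      · by_contra hcon
        push Not at hcon
        exact hk (hi' k hcon.1 hcon.2)
      · rintro (rfl | rfl)
        · exact hane
        · exact fun h0 => hane (hab0.2 h0)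
    choose! F hF using hvert
    have hFinj : Set.InjOn F (Pp ×ˢ Mm : Finset (κ × κ)) := by
      rintro ⟨a, b⟩ hab ⟨a', b'⟩ hab' heqF
      have h1 := hF _ (Finset.mem_coe.1 hab)
      have h2 := hF _ (Finset.mem_coe.1 hab')
      rw [heqF] at h1
      have h3 : ∀ k, (k = a ∨ k = b) ↔ (k = a' ∨ k = b') := fun k => (h1 k).symm.trans (h2 k)
      simp only [Finset.coe_product, Set.mem_prod, Finset.mem_coe, Pp, Mm, Finset.mem_filter,
        Finset.mem_univ, true_and] at hab hab'
      have ha : a = a' := by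
        rcases (h3 a).1 (Or.inl rfl) with h | h
        · exact h
        · subst h; linarith [hab.1, hab'.2]
      have hb : b = b' := by
        rcases (h3 b).1 (Or.inr rfl) with h | h
        · subst h; linarith [hab.2, hab'.1]
        · exact h
      rw [ha, hb]
    have hfin : (Pp ×ˢ Mm).card ≤ Fintype.card ι :=
      Finset.card_le_card_of_injOn F (fun _ _ => Finset.mem_univ _) hFinj
    rw [Finset.card_product] at hfin
    have : 2 * (Pp.card + Mm.card) ≤ Pp.card * Mm.card + 4 := by
      obtain ⟨p, hp⟩ := Nat.exists_eq_add_of_le hP2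
      obtain ⟨q, hq⟩ := Nat.exists_eq_add_of_le hM2
      rw [hp, hq]
      nlinarith [Nat.zero_le (p * q)]
    omega

end Core

lemma finrank_map_inj {V W : Type*} [AddCommGroup V] [Module ℝ V] [AddCommGroup W] [Module ℝ W]
    (p : Submodule ℝ V) (f : V →ₗ[ℝ] W) (hf : Function.Injective f) :
    Module.finrank ℝ (p.map f) = Module.finrank ℝ p :=
  (LinearEquiv.finrank_eq (Submodule.equivMapOfInjective f hf p)).symm

section Poly

variable {E : Type*} [AddCommGroup E] [Module ℝ E]

/-- homogenization -/
def lft (x : E) : E × ℝ := (x, 1)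

lemma finrank_span_lft (T : Set E) (hT : T.Finite) (hne : T.Nonempty) :
    Module.finrank ℝ (Submodule.span ℝ (lft '' T)) = Module.finrank ℝ (vectorSpan ℝ T) + 1 := by
  obtain ⟨t0, ht0⟩ := hne
  have hfd : FiniteDimensional ℝ (vectorSpan ℝ T) := finiteDimensional_vectorSpan_of_finite ℝ hT
  have e : Submodule.span ℝ (lft '' T) =
      Submodule.span ℝ {lft t0} ⊔ (vectorSpan ℝ T).map (LinearMap.inl ℝ E ℝ) := by
    apply le_antisymm
    · rw [Submodule.span_le]
      rintro _ ⟨t, ht, rfl⟩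
      have : lft t = lft t0 + LinearMap.inl ℝ E ℝ (t - t0) := by simp [lft]
      rw [this]
      refine add_mem (Submodule.mem_sup_left (Submodule.mem_span_singleton_self _))
        (Submodule.mem_sup_right (Submodule.mem_map_of_mem ?_))
      exact vsub_mem_vectorSpan ℝ ht ht0
    · refine sup_le ?_ ?_
      · exact Submodule.span_mono (by simpa using ⟨t0, ht0, rfl⟩)
      · rw [vectorSpan_eq_span_vsub_set_right ℝ ht0, Submodule.map_span, Submodule.span_le]
        rintro _ ⟨_, ⟨t, ht, rfl⟩, rfl⟩
        have : LinearMap.inl ℝ E ℝ (t -ᵥ t0) = lft t - lft t0 := by simp [lft]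
        change LinearMap.inl ℝ E ℝ (t -ᵥ t0) ∈ _
        rw [this]
        exact sub_mem (Submodule.subset_span ⟨t, ht, rfl⟩) (Submodule.subset_span ⟨t0, ht0, rfl⟩)
  have hdis : Submodule.span ℝ {(lft t0 : E × ℝ)} ⊓ (vectorSpan ℝ T).map (LinearMap.inl ℝ E ℝ) = ⊥ := by
    rw [eq_bot_iff]
    rintro x ⟨h1, h2⟩
    obtain ⟨c, rfl⟩ := Submodule.mem_span_singleton.1 h1
    obtain ⟨y, -, hy⟩ := h2
    have := congrArg Prod.snd hy
    simp [lft] at this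
    simp [← this]
  have h3 := Submodule.finrank_sup_add_finrank_inf_eq (Submodule.span ℝ {(lft t0 : E × ℝ)})
    ((vectorSpan ℝ T).map (LinearMap.inl ℝ E ℝ))
  rw [hdis, ← e] at h3
  rw [finrank_span_singleton (by simp [lft]),
    finrank_map_inj _ _ LinearMap.inl_injective] at h3
  simp at h3
  omega

lemma face_eq {S : Set E} {A : Set E} (hA : IsFace (convexHull ℝ S) A) :
    A = convexHull ℝ (A ∩ S) := by
  obtain ⟨⟨hsub, hext⟩, hconv⟩ := hA
  apply Subset.antisymm
  · intro x hx
    have hdc : convexHull ℝ (S \ A) ⊆ convexHull ℝ S \ A :=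
      convexHull_min (sdiff_subset_sdiff_left (subset_convexHull ℝ S))
        (IsExtreme.convex_sdiff (convex_convexHull ℝ S) ⟨hsub, hext⟩)
    have hS : S = (A ∩ S) ∪ (S \ A) := by
      ext y; simp; tauto
    rcases (A ∩ S).eq_empty_or_nonempty with h1 | h1
    · have : x ∈ convexHull ℝ (S \ A) := by
        have h2 : S \ A = S := by conv_rhs => rw [hS, h1, empty_union]
        rw [h2]; exact hsub hx
      exact absurd hx (hdc this).2
    rcases (S \ A).eq_empty_or_nonempty with h2 | h2
    · have : A ∩ S = S := by conv_rhs => rw [hS, h2, union_empty]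
      rw [this]; exact hsub hx
    have hx' : x ∈ convexHull ℝ ((A ∩ S) ∪ (S \ A)) := by rw [← hS]; exact hsub hx
    rw [convexHull_union h1 h2, mem_convexJoin] at hx'
    obtain ⟨a, ha, b, hb, hxab⟩ := hx'
    have hb' := hdc hb
    have ha' : a ∈ convexHull ℝ S := convexHull_mono inter_subset_right ha
    rw [← insert_endpoints_openSegment] at hxab
    rcases hxab with rfl | rfl | hxab
    · exact ha
    · exact absurd hx hb'.2
    · rw [openSegment_symm] at hxab
      exact absurd (hext hb'.1 ha' hx hxab) hb'.2
  · exact convexHull_min inter_subset_left hconv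

lemma extreme_of_not_mem {S : Set E} {x : E} (hx : x ∈ S) (h : x ∉ convexHull ℝ (S \ {x})) :
    x ∈ (convexHull ℝ S).extremePoints ℝ := by
  rcases (S \ {x}).eq_empty_or_nonempty with h0 | hne
  · have : S = {x} := Subset.antisymm (sdiff_eq_empty.1 h0) (by simpa using hx)
    subst this
    simp
  have hS : S = insert x (S \ {x}) := by simp [insert_eq_of_mem hx]
  have hrep : ∀ y ∈ convexHull ℝ S, ∃ c ∈ convexHull ℝ (S \ {x}), ∃ s : ℝ, 0 ≤ s ∧
      y = x + s • (c - x) := by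
    intro y hy
    rw [hS, convexHull_insert hne, mem_convexJoin] at hy
    obtain ⟨a, ha, c, hc, hy⟩ := hy
    rw [mem_singleton_iff] at ha
    subst ha
    rw [segment_eq_image'] at hy
    obtain ⟨s, hs, rfl⟩ := hy
    exact ⟨c, hc, s, hs.1, rfl⟩
  rw [mem_extremePoints_iff_left]
  refine ⟨subset_convexHull ℝ S hx, ?_⟩
  intro x1 h1 x2 h2 hx12
  obtain ⟨c1, hc1, s, hs, rfl⟩ := hrep x1 h1
  obtain ⟨c2, hc2, t, ht, rfl⟩ := hrep x2 h2
  obtain ⟨a, b, ha, hb, hab, he⟩ := hx12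
  by_cases hs0 : s = 0
  · simp [hs0]
  exfalso
  apply h
  have hs' : 0 < s := lt_of_le_of_ne hs (Ne.symm hs0)
  have hpos : 0 < a * s + b * t := by positivity
  have he' : (a * s + b * t) • x = (a * s) • c1 + (b * t) • c2 := by
    have : (a + b) • x + ((a * s) • c1 + (b * t) • c2 - (a * s + b * t) • x) = x := by
      conv_rhs => rw [← he]
      module
    rw [hab, one_smul, add_eq_left, sub_eq_zero] at this
    exact this.symm
  have hxe : x = (a * s / (a * s + b * t)) • c1 + (b * t / (a * s + b * t)) • c2 := by
    have := congrArg (fun y => (a * s + b * t)⁻¹ • y) he'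
    simp only [smul_smul, inv_mul_cancel₀ hpos.ne', one_smul, smul_add] at this
    rw [this]
    congr 2 <;> ring
  have hm := (convex_convexHull ℝ (S \ {x})) hc1 hc2
    (a := a * s / (a * s + b * t)) (b := b * t / (a * s + b * t))
    (by positivity) (by positivity) (by rw [← add_div, div_self hpos.ne'])
  rwa [← hxe] at hm

lemma exists_min_gen {P : Set E} (hP : IsPolytope P) : ∃ S : Finset E, S.Nonempty ∧
    P = convexHull ℝ (S : Set E) ∧ (S : Set E) = P.extremePoints ℝ := by
  classical
  obtain ⟨S0, hne0, hP0⟩ := hP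
  have hex : ∃ n, ∃ S : Finset E, S.card = n ∧ P = convexHull ℝ (S : Set E) := ⟨_, S0, rfl, hP0⟩
  obtain ⟨S, hSc, hS⟩ := Nat.find_spec hex
  have hne : S.Nonempty := by
    rw [Finset.nonempty_iff_ne_empty]
    rintro rfl
    have : (convexHull ℝ (S0 : Set E)).Nonempty := by simpa using hne0
    rw [← hP0, hS] at this
    simp at this
  refine ⟨S, hne, hS, Subset.antisymm ?_ ?_⟩
  · intro x hx
    rw [hS]
    apply extreme_of_not_mem hx
    intro hcon
    have h1 : P = convexHull ℝ ((S.erase x : Finset E) : Set E) := by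
      rw [hS, Finset.coe_erase]
      apply Subset.antisymm
      · apply convexHull_min _ (convex_convexHull ℝ _)
        intro y hy
        by_cases hyx : y = x
        · subst hyx; exact hcon
        · exact subset_convexHull ℝ _ ⟨hy, hyx⟩
      · exact convexHull_mono sdiff_subset
    have h2 := Nat.find_min' hex ⟨S.erase x, rfl, h1⟩
    have h3 := Finset.card_erase_lt_of_mem (Finset.mem_coe.1 hx)
    omega
  · rw [hS]; exact extremePoints_convexHull_subset

lemma pdim_convexHull (T : Set E) : pdim (convexHull ℝ T) = Module.finrank ℝ (vectorSpan ℝ T) := by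
  unfold pdim
  rw [affineSpan_convexHull, direction_affineSpan]

end Poly

section Main

variable {E : Type*} [AddCommGroup E] [Module ℝ E]

/-- the homogenized vertices inside their span -/
def vv (S : Finset E) (i : S) : Submodule.span ℝ (lft '' (S : Set E)) :=
  ⟨lft (i : E), Submodule.subset_span ⟨i, i.2, rfl⟩⟩

lemma span_vv (S : Finset E) : Submodule.span ℝ (range (vv S)) = ⊤ := by
  apply Submodule.map_injective_of_injective (Submodule.span ℝ (lft '' (S : Set E))).injective_subtype
  rw [Submodule.map_span, Submodule.map_top, Submodule.range_subtype]
  congr 1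
  ext x
  simp only [mem_image, mem_range, exists_exists_eq_and]
  constructor
  · rintro ⟨i, rfl⟩; exact ⟨i, i.2, rfl⟩
  · rintro ⟨i, hi, rfl⟩; exact ⟨⟨i, hi⟩, rfl⟩

lemma facet_of (S : Finset E) (hS : S.Nonempty)
    (l : Submodule.span ℝ (lft '' (S : Set E)) →ₗ[ℝ] ℝ) (hl : Facetlike (vv S) l)
    (hz : ∃ i, l (vv S i) = 0) :
    IsFacet (convexHull ℝ (S : Set E)) (convexHull ℝ (Subtype.val '' {i : S | l (vv S i) = 0})) ∧
    convexHull ℝ (Subtype.val '' {i : S | l (vv S i) = 0}) ∩ S =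
      Subtype.val '' {i : S | l (vv S i) = 0} := by
  classical
  set Z : Set E := Subtype.val '' {i : S | l (vv S i) = 0} with hZ
  have hZne : Z.Nonempty := by obtain ⟨i, hi⟩ := hz; exact ⟨i, i, hi, rfl⟩
  have hZS : Z ⊆ S := by rintro _ ⟨i, -, rfl⟩; exact i.2
  obtain ⟨L, hL⟩ := LinearMap.exists_extend l
  have hLv : ∀ i : S, L (lft (i : E)) = l (vv S i) := fun i => by rw [← hL]; rfl
  have hcomb : ∀ (a b : ℝ) (x y : E), a + b = 1 →
      L (lft (a • x + b • y)) = a * L (lft x) + b * L (lft y) := by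
    intro a b x y hab
    have : lft (a • x + b • y) = a • lft x + b • lft y := by simp [lft, hab]
    rw [this]; simp
  have hpos : ∀ x ∈ convexHull ℝ (S : Set E), 0 ≤ L (lft x) := by
    have : convexHull ℝ (S : Set E) ⊆ {x | 0 ≤ L (lft x)} := by
      apply convexHull_min
      · intro x hx
        have := hl.1 ⟨x, hx⟩
        rw [← hLv] at this
        exact this
      · intro x hx y hy a b ha hb hab
        rw [mem_ofPred_eq, hcomb a b x y hab]
        exact add_nonneg (mul_nonneg ha hx) (mul_nonneg hb hy)
    exact this
  let A : Set E := {x | x ∈ convexHull ℝ (S : Set E) ∧ L (lft x) = 0}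
  have hAS : A ∩ S = Z := by
    ext x
    constructor
    · rintro ⟨hx, hxS⟩
      refine ⟨⟨x, hxS⟩, ?_, rfl⟩
      change l _ = 0
      rw [← hLv]; exact hx.2
    · rintro ⟨i, hi, rfl⟩
      exact ⟨⟨subset_convexHull ℝ _ i.2, by rw [hLv]; exact hi⟩, i.2⟩
  have hface : IsFace (convexHull ℝ (S : Set E)) A := by
    refine ⟨⟨fun x hx => hx.1, ?_⟩, ?_⟩
    · rintro x hx y hy z hz ⟨a, b, ha, hb, hab, rfl⟩
      have h1 := hz.2
      rw [hcomb a b x y hab] at h1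
      have h2 := hpos x hx
      have h3 := hpos y hy
      have h4 := mul_nonneg hb.le h3
      have h5 := mul_nonneg ha.le h2
      have h6 : a * L (lft x) = 0 := by linarith
      exact ⟨hx, (mul_eq_zero.1 h6).resolve_left ha.ne'⟩
    · intro x hx y hy a b ha hb hab
      refine ⟨convex_convexHull ℝ _ hx.1 hy.1 ha hb hab, ?_⟩
      rw [hcomb a b x y hab, hx.2, hy.2]; simp
  have hAe : A = convexHull ℝ Z := by rw [← hAS]; exact face_eq hface
  refine ⟨⟨by simpa using hZne, hAe ▸ hface, ?_⟩, by rw [← hAe]; exact hAS⟩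
  rw [pdim_convexHull, pdim_convexHull]
  have hfin : Z.Finite := S.finite_toSet.subset hZS
  have d1 := finrank_span_lft Z hfin hZne
  have d2 := finrank_span_lft (S : Set E) S.finite_toSet (by simpa using hS)
  have hFD : FiniteDimensional ℝ (Submodule.span ℝ (lft '' (S : Set E))) :=
    FiniteDimensional.span_of_finite ℝ (S.finite_toSet.image _)
  have d3 := Module.Dual.finrank_ker_add_one_of_ne_zero (K := ℝ) (f := l) hl.2.1
  have hk : Submodule.span ℝ (vv S '' {i : S | l (vv S i) = 0}) = LinearMap.ker l := by
    apply le_antisymm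
    · rw [Submodule.span_le]
      rintro _ ⟨i, hi, rfl⟩
      exact hi
    · intro u hu
      by_contra hcon
      obtain ⟨g, hg0, hg⟩ := Submodule.exists_le_ker_of_notMem hcon
      obtain ⟨c, hc⟩ := hl.2.2 g (fun i hi => hg (Submodule.subset_span ⟨i, hi, rfl⟩))
      apply hg0
      rw [hc, LinearMap.smul_apply, LinearMap.mem_ker.1 hu, smul_zero]
  have hm : (LinearMap.ker l).map (Submodule.subtype _) = Submodule.span ℝ (lft '' Z) := by
    rw [← hk, Submodule.map_span]
    congr 1
    rw [hZ, image_image, image_image]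
    rfl
  have d4 := finrank_map_inj (LinearMap.ker l) _
    (Submodule.injective_subtype (Submodule.span ℝ (lft '' (S : Set E))))
  rw [hm] at d4
  omega

lemma facets_finite (S : Finset E) : {A : Set E | IsFacet (convexHull ℝ (S : Set E)) A}.Finite := by
  apply Set.Finite.of_finite_image (f := fun A => A ∩ (S : Set E))
  · apply S.finite_toSet.finite_subsets.subset
    rintro _ ⟨A, -, rfl⟩
    exact inter_subset_right
  · intro A hA B hB hAB
    rw [face_eq hA.2.1, face_eq hB.2.1]
    dsimp at hAB
    rw [hAB]

end Main

/-- A d-polytope with at most d+2 facets that is not a pyramid has at least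
2d vertices (equivalently, d ≤ α + 1 where the number of vertices is d + 1 + α). -/
theorem stmt4 {E : Type*} [AddCommGroup E] [Module ℝ E]
    (P : Set E) (hP : IsPolytope P)
    (hf : numFacets P ≤ pdim P + 2) (hnp : ¬ IsPyramid P) :
    2 * pdim P ≤ numVertices P := by
  classical
  obtain ⟨S, hSne, hPS, hSe⟩ := exists_min_gen hP
  rcases Nat.eq_zero_or_pos (pdim P) with hd | hd
  · omega
  have hFD : FiniteDimensional ℝ (Submodule.span ℝ (lft '' (S : Set E))) :=
    FiniteDimensional.span_of_finite ℝ (S.finite_toSet.image _)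
  have hdim : Module.finrank ℝ (Submodule.span ℝ (lft '' (S : Set E))) = pdim P + 1 := by
    rw [finrank_span_lft _ S.finite_toSet (by simpa using hSne), hPS, pdim_convexHull]
  have hz : ∀ l, Facetlike (vv S) l → ∃ i, l (vv S i) = 0 := by
    intro l hl
    by_contra hcon
    push Not at hcon
    have h1 : Module.finrank ℝ (Module.Dual ℝ (Submodule.span ℝ (lft '' (S : Set E)))) ≤ 1 := by
      apply finrank_le_one l
      intro g
      obtain ⟨c, hc⟩ := hl.2.2 g (fun i hi => absurd hi (hcon i))
      exact ⟨c, hc.symm⟩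
    rw [Subspace.dual_finrank_eq] at h1
    omega
  let ZZ : Set (Set S) := {Z | ∃ l, Facetlike (vv S) l ∧ Z = {i : S | l (vv S i) = 0}}
  have hch : ∀ Z : ZZ, ∃ l, Facetlike (vv S) l ∧ Z.1 = {i : S | l (vv S i) = 0} := fun Z => Z.2
  choose l hl hlZ using hch
  have hcardZ : Fintype.card ZZ ≤ numFacets P := by
    have hfac : ∀ Z : ZZ, IsFacet (convexHull ℝ (S : Set E)) (convexHull ℝ (Subtype.val '' Z.1)) ∧
        convexHull ℝ (Subtype.val '' Z.1) ∩ S = Subtype.val '' Z.1 := by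
      intro Z
      have := facet_of S hSne (l Z) (hl Z) (hz _ (hl Z))
      rwa [← hlZ Z] at this
    unfold numFacets
    rw [← Nat.card_eq_fintype_card, Nat.card_coe_set_eq, hPS]
    refine Set.ncard_le_ncard_of_injOn (fun Z => convexHull ℝ (Subtype.val '' Z)) ?_ ?_
      (facets_finite S)
    · intro Z hZ
      exact (hfac ⟨Z, hZ⟩).1
    · intro Z hZ Z' hZ' he
      dsimp at he
      have h1 := (hfac ⟨Z, hZ⟩).2
      have h2 := (hfac ⟨Z', hZ'⟩).2
      dsimp at h1 h2
      rw [he, h2] at h1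
      exact (Subtype.val_injective.image_injective h1).symm
  let h : Submodule.span ℝ (lft '' (S : Set E)) →ₗ[ℝ] ℝ :=
    (LinearMap.snd ℝ E ℝ).comp (Submodule.subtype _)
  have hh : ∀ i, h (vv S i) = 1 := fun i => rfl
  have hcone : ∀ x, (∀ k, 0 ≤ l k x) →
      ∃ c : S → ℝ, (∀ i, 0 ≤ c i) ∧ x = ∑ i, c i • vv S i := by
    intro x hx
    apply farkas_aux Finset.univ (vv S) x
    intro g hg
    by_contra hcon
    push Not at hcon
    obtain ⟨g', hg', hgx⟩ := sep_facet (vv S) (span_vv S) x _ g le_rfl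
      (fun i => hg i (Finset.mem_univ _)) hcon
    let Z : ZZ := ⟨{i : S | g' (vv S i) = 0}, g', hg', rfl⟩
    have hZ : {i : S | g' (vv S i) = 0} = {i : S | l Z (vv S i) = 0} := hlZ Z
    obtain ⟨c, hc⟩ := (hl Z).2.2 g' (fun i hi => by
      have : i ∈ {i : S | l Z (vv S i) = 0} := hi
      rw [← hZ] at this
      exact this)
    have hc0 : 0 ≤ c := by
      by_contra hneg
      push Not at hneg
      apply hg'.2.1
      apply LinearMap.ext_on_range (span_vv S)
      intro i
      have h1 := hg'.1 i
      have h2 := mul_nonpos_of_nonpos_of_nonneg hneg.le ((hl Z).1 i)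
      have h3 : g' (vv S i) = c * l Z (vv S i) := by rw [hc]; rfl
      rw [LinearMap.zero_apply]
      linarith
    have : g' x = c * l Z x := by rw [hc]; rfl
    have h2 := mul_nonneg hc0 (hx Z)
    linarith
  have hmain := core (vv S) h hh l (fun k => (hl k).1) (fun k => hz _ (hl k)) hcone
    ⟨⟨hSne.choose, hSne.choose_spec⟩⟩ (by omega)
  rcases hmain with hmain | ⟨k, i0, hk0, hw⟩
  · unfold numVertices
    rw [← hSe, Set.ncard_coe_finset]
    simp only [Fintype.card_coe] at hmain
    omega
  · exfalso
    apply hnp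
    set Z : Finset E := S.filter fun x => ∃ hx : x ∈ S, l k (vv S ⟨x, hx⟩) = 0 with hZ
    have hZm : ∀ i : S, l k (vv S i) = 0 → (i : E) ∈ Z := fun i hi => by
      rw [hZ, Finset.mem_filter]; exact ⟨i.2, i.2, hi⟩
    refine ⟨convexHull ℝ (Z : Set E), i0, ⟨Z, ?_, rfl⟩, ?_, ?_⟩
    · obtain ⟨i, hi⟩ := hz _ (hl k)
      exact ⟨i, hZm i hi⟩
    · obtain ⟨L, hL⟩ := LinearMap.exists_extend (l k)
      have hLv : ∀ i : S, L (lft (i : E)) = l k (vv S i) := fun i => by rw [← hL]; rfl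
      rw [affineSpan_convexHull]
      intro hcon
      apply hk0
      rw [← hLv]
      refine affineSpan_induction (p := fun x => L (lft x) = 0) hcon ?_ ?_
      · intro x hx
        obtain ⟨-, hxS, hx0⟩ := Finset.mem_filter.1 (Finset.mem_coe.1 hx)
        rw [← hLv] at hx0
        exact hx0
      · intro c x y z hx hy hz
        have : lft (c • (x -ᵥ y) +ᵥ z) = c • (lft x - lft y) + lft z := by simp [lft]
        rw [this]
        simp [hx, hy, hz]
    · rw [hPS]
      apply Subset.antisymm
      · apply convexHull_min _ (convex_convexHull ℝ _)
        intro w hwS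
        obtain ⟨c, hc, hsum, hsupp⟩ := hw ⟨w, hwS⟩
        have e1 : ∑ i, c i = 1 := by
          have := congrArg h hsum
          rw [hh, map_sum] at this
          simp [hh] at this
          exact this.symm
        have e2 : w = ∑ i : S, c i • (i : E) := by
          have := congrArg
            (fun u : Submodule.span ℝ (lft '' (S : Set E)) => (u : E × ℝ).1) hsum
          simp only [AddSubmonoidClass.coe_finset_sum, Prod.fst_sum] at this
          exact this
        rw [e2, ← Finset.sum_filter_of_ne (p := fun i => c i ≠ 0)
          (by intro i _ hi h0; apply hi; rw [h0, zero_smul])]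
        have e3 : ∑ i with c i ≠ 0, c i = 1 := by
          rw [← e1]; exact Finset.sum_filter_ne_zero _
        apply (convex_convexHull ℝ _).sum_mem (fun i _ => hc i) e3
        intro i hi
        apply subset_convexHull
        rcases hsupp i (Finset.mem_filter.1 hi).2 with rfl | h0
        · right; rfl
        · left; exact subset_convexHull ℝ _ (hZm i h0)
      · apply convexHull_min _ (convex_convexHull ℝ _)
        rintro x (hx | rfl)
        · exact convexHull_mono (by exact_mod_cast Finset.filter_subset _ _) hx
        · exact subset_convexHull ℝ _ i0.2
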